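/- Let e ≥ 10 be an integer. The defining toric ideal I_{S(e,1,4)} of the numerical semigroup S(e,1,4) inside R(e,1,4) = K[x_0, x_2, x_3, x_5, x_6, …, x_{e−1}] is generated, minimally, by the set G = J ∪ K ∪ L, where J = {x_i x_{j+1} − x_{i+1} x_j : i < j, i, j ∈ {2} ∪ {5,…,e−2}} ∪ {x_0^2 x_i − x_{i+1} x_{e−1} : i ∈ {2} ∪ {5,…,e−2}}, K = {x_0 x_{i+2} − x_2 x_i : i ∈ {3} ∪ {5,…,e−3}} ∪ {x_0^3 − x_2 x_{e−2}}, and L = {x_5 x_{5+i} − x_3 x_{7+i} : 0 ≤ i ≤ e−8} ∪ {x_3^2 − x_0 x_6} ∪ {x_0^2 x_3 − x_5 x_{e−2}, x_0 x_2^2 − x_5 x_{e−1}, x_2^3 − x_7 x_{e−1}}. -/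

import Mathlib

open MvPolynomial

/-- Index set of the polynomial ring `R(e,m,n)`: indices `i ∈ {0,…,e−1} \ {m,n}`. -/
abbrev SallyIdx (e m n : ℕ) : Type := {i : ℕ // i < e ∧ i ≠ m ∧ i ≠ n}

/-- The variable `x_i` of `R(e,m,n)` (and `0` for an invalid index). -/
noncomputable def sX (e m n : ℕ) (i : ℕ) : MvPolynomial (SallyIdx e m n) ℚ :=
  if h : i < e ∧ i ≠ m ∧ i ≠ n then MvPolynomial.X ⟨i, h⟩ else 0

/-- The defining toric ideal `I_{S(e,m,n)}`: the kernel of the `ℚ`-algebra homomorphism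
`R(e,m,n) → ℚ[t]` sending `x_i ↦ t^{e+i}`. -/
noncomputable def sallyIdeal (e m n : ℕ) : Ideal (MvPolynomial (SallyIdx e m n) ℚ) :=
  RingHom.ker (MvPolynomial.aeval
    (fun i : SallyIdx e m n => (Polynomial.X : Polynomial ℚ) ^ (e + i.1))).toRingHom

/-- The generating set `G = J ∪ K ∪ L` for `I_{S(e,1,4)}`. -/
noncomputable def genSet (e : ℕ) : Set (MvPolynomial (SallyIdx e 1 4) ℚ) :=
  -- J
  {p | ∃ i j : ℕ, (i = 2 ∨ (5 ≤ i ∧ i ≤ e - 2)) ∧ (j = 2 ∨ (5 ≤ j ∧ j ≤ e - 2)) ∧ i < j ∧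
      p = sX e 1 4 i * sX e 1 4 (j+1) - sX e 1 4 (i+1) * sX e 1 4 j} ∪
  {p | ∃ i : ℕ, (i = 2 ∨ (5 ≤ i ∧ i ≤ e - 2)) ∧
      p = sX e 1 4 0 ^ 2 * sX e 1 4 i - sX e 1 4 (i+1) * sX e 1 4 (e-1)} ∪
  -- K
  {p | ∃ i : ℕ, (i = 3 ∨ (5 ≤ i ∧ i ≤ e - 3)) ∧
      p = sX e 1 4 0 * sX e 1 4 (i+2) - sX e 1 4 2 * sX e 1 4 i} ∪
  {sX e 1 4 0 ^ 3 - sX e 1 4 2 * sX e 1 4 (e-2)} ∪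
  -- L
  {p | ∃ i : ℕ, i ≤ e - 8 ∧
      p = sX e 1 4 5 * sX e 1 4 (5+i) - sX e 1 4 3 * sX e 1 4 (7+i)} ∪
  {sX e 1 4 3 ^ 2 - sX e 1 4 0 * sX e 1 4 6} ∪
  {sX e 1 4 0 ^ 2 * sX e 1 4 3 - sX e 1 4 5 * sX e 1 4 (e-2),
   sX e 1 4 0 * sX e 1 4 2 ^ 2 - sX e 1 4 5 * sX e 1 4 (e-1),
   sX e 1 4 2 ^ 3 - sX e 1 4 7 * sX e 1 4 (e-1)}

/-- The relations that the binomials of `genSet e` impose on a sequence `y` of ring elements. -/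
structure SallyRel {A : Type*} [CommRing A] (e : ℕ) (y : ℕ → A) : Prop where
  J : ∀ i j, (i = 2 ∨ (5 ≤ i ∧ i ≤ e - 2)) → (j = 2 ∨ (5 ≤ j ∧ j ≤ e - 2)) → i < j →
    y i * y (j + 1) = y (i + 1) * y j
  J0 : ∀ i, (i = 2 ∨ (5 ≤ i ∧ i ≤ e - 2)) → y 0 ^ 2 * y i = y (i + 1) * y (e - 1)
  K : ∀ i, (i = 3 ∨ (5 ≤ i ∧ i ≤ e - 3)) → y 0 * y (i + 2) = y 2 * y i
  K0 : y 0 ^ 3 = y 2 * y (e - 2)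
  L : ∀ i, i ≤ e - 8 → y 5 * y (5 + i) = y 3 * y (7 + i)
  L33 : y 3 ^ 2 = y 0 * y 6
  L3 : y 0 ^ 2 * y 3 = y 5 * y (e - 2)
  L4 : y 0 * y 2 ^ 2 = y 5 * y (e - 1)
  L6 : y 2 ^ 3 = y 7 * y (e - 1)

/-- `SallyNF e y d a` says that `a` is the normal form of degree `d`: a power of `y 0` times the
monomial attached to an element of the Apéry set of the semigroup with respect to `e`. -/
inductive SallyNF {A : Type*} [CommRing A] (e : ℕ) (y : ℕ → A) : ℕ → A → Prop
  | pow (k : ℕ) : SallyNF e y (k * e) (y 0 ^ k)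
  | var (k i : ℕ) (hi : i = 2 ∨ i = 3 ∨ (5 ≤ i ∧ i < e)) :
      SallyNF e y ((k + 1) * e + i) (y 0 ^ k * y i)
  | sq (k : ℕ) : SallyNF e y ((k + 2) * e + 4) (y 0 ^ k * y 2 ^ 2)
  | last (k : ℕ) : SallyNF e y ((k + 3) * e + 1) (y 0 ^ k * (y 2 * y (e - 1)))

theorem eq_and_eq_of_mul_add_eq {e a b r s : ℕ} (hr : r < e) (hs : s < e)
    (h : a * e + r = b * e + s) : a = b ∧ r = s := by
  have h1 : r = s := by
    have := congrArg (· % e) h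
    simpa [Nat.mul_add_mod', Nat.mod_eq_of_lt hr, Nat.mod_eq_of_lt hs] using this
  subst h1
  exact ⟨Nat.eq_of_mul_eq_mul_right (by omega) (Nat.add_right_cancel h), rfl⟩

namespace SallyNF

variable {A : Type*} [CommRing A] {e : ℕ} {y : ℕ → A}

theorem exists_apery {d : ℕ} {a : A} (he : 10 ≤ e) (h : SallyNF e y d a) :
    ∃ q r, r < e ∧ d = q * e + r ∧
      a = (if r = 0 then y 0 ^ q else if r = 1 then y 0 ^ (q - 3) * (y 2 * y (e - 1))
        else if r = 4 then y 0 ^ (q - 2) * y 2 ^ 2 else y 0 ^ (q - 1) * y r) := by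
  cases h with
  | pow k => exact ⟨k, 0, by omega, rfl, by simp⟩
  | var k i hi =>
    refine ⟨k + 1, i, by omega, rfl, ?_⟩
    rw [if_neg (by omega), if_neg (by omega), if_neg (by omega)]
    simp
  | sq k => exact ⟨k + 2, 4, by omega, rfl, by simp⟩
  | last k => exact ⟨k + 3, 1, by omega, rfl, by simp⟩

theorem unique {d : ℕ} {a b : A} (he : 10 ≤ e) (ha : SallyNF e y d a) (hb : SallyNF e y d b) :
    a = b := by
  obtain ⟨q, r, hr, hd, rfl⟩ := ha.exists_apery he
  obtain ⟨q', r', hr', hd', rfl⟩ := hb.exists_apery he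
  obtain ⟨rfl, rfl⟩ := eq_and_eq_of_mul_add_eq hr hr' (hd.symm.trans hd')
  rfl

theorem of_eq {d d' : ℕ} {a a' : A} (h : SallyNF e y d a) (hd : d' = d) (ha : a' = a) :
    SallyNF e y d' a' := by
  subst hd ha
  exact h

theorem pow_mul {d : ℕ} {a : A} (h : SallyNF e y d a) (l : ℕ) :
    SallyNF e y (l * e + d) (y 0 ^ l * a) := by
  cases h with
  | pow k => exact (pow (k + l)).of_eq (by ring) (by ring)
  | var k i hi => exact (var (k + l) i hi).of_eq (by ring) (by ring)
  | sq k => exact (sq (k + l)).of_eq (by ring) (by ring)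
  | last k => exact (last (k + l)).of_eq (by ring) (by ring)

theorem mul_two (he : 10 ≤ e) (h : SallyRel e y) {j : ℕ} (hj : j = 2 ∨ j = 3 ∨ (5 ≤ j ∧ j < e)) :
    SallyNF e y (2 * e + 2 + j) (y 2 * y j) := by
  obtain rfl | hj' | rfl | rfl : j = 2 ∨ (j = 3 ∨ (5 ≤ j ∧ j ≤ e - 3)) ∨ j = e - 2 ∨ j = e - 1 := by
    omega
  · exact (sq 0).of_eq (by ring) (by ring)
  · exact (var 1 (j + 2) (by omega)).of_eq (by ring) (by rw [← h.K j hj']; ring)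
  · exact (pow 3).of_eq (by omega) h.K0.symm
  · exact (last 0).of_eq (by omega) (by ring)

theorem mul_three (he : 10 ≤ e) (h : SallyRel e y) {j : ℕ} (hj : j = 3 ∨ (5 ≤ j ∧ j < e)) :
    SallyNF e y (2 * e + 3 + j) (y 3 * y j) := by
  obtain rfl | hj' | rfl : j = 3 ∨ (5 ≤ j ∧ j ≤ e - 2) ∨ j = e - 1 := by omega
  · exact (var 1 6 (by omega)).of_eq (by ring) (by linear_combination h.L33)
  · exact (mul_two he h (j := j + 1) (by omega)).of_eq (by ring)
      (h.J 2 j (by omega) (by omega) (by omega)).symm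
  · exact (var 2 2 (by omega)).of_eq (by omega) (h.J0 2 (by omega)).symm

theorem mul_five (he : 10 ≤ e) (h : SallyRel e y) {j : ℕ} (hj : 5 ≤ j ∧ j < e) :
    SallyNF e y (2 * e + 5 + j) (y 5 * y j) := by
  obtain ⟨i, hi, rfl⟩ | rfl | rfl : (∃ i, i ≤ e - 8 ∧ j = 5 + i) ∨ j = e - 2 ∨ j = e - 1 := by
    by_cases hj' : j ≤ e - 3
    · exact Or.inl ⟨j - 5, by omega, by omega⟩
    · omega
  · exact (mul_three he h (j := 7 + i) (by omega)).of_eq (by ring) (h.L i hi)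
  · exact (var 2 3 (by omega)).of_eq (by omega) h.L3.symm
  · exact (sq 1).of_eq (by omega) (by rw [← h.L4]; ring)

theorem mul_large (he : 10 ≤ e) (h : SallyRel e y) :
    ∀ n j, 5 + n ≤ j → j < e → SallyNF e y (2 * e + (5 + n) + j) (y (5 + n) * y j) := by
  intro n
  induction n with
  | zero => exact fun j h1 h2 => mul_five he h ⟨h1, h2⟩
  | succ n ih =>
    intro j h1 h2
    by_cases hj : j = e - 1
    · subst hj
      exact (var 2 (5 + n) (by omega)).of_eq (by omega) (h.J0 (5 + n) (by omega)).symm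
    · exact (ih (j + 1) (by omega) (by omega)).of_eq (by ring)
        (h.J (5 + n) j (by omega) (by omega) (by omega)).symm

theorem mul_var (he : 10 ≤ e) (h : SallyRel e y) {i j : ℕ}
    (hi : i = 2 ∨ i = 3 ∨ (5 ≤ i ∧ i < e)) (hj : j = 2 ∨ j = 3 ∨ (5 ≤ j ∧ j < e)) :
    SallyNF e y (2 * e + i + j) (y i * y j) := by
  wlog hij : i ≤ j generalizing i j
  · exact (this hj hi (by omega)).of_eq (by ring) (mul_comm _ _)
  obtain rfl | rfl | hi : i = 2 ∨ i = 3 ∨ 5 ≤ i := by omega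
  · exact mul_two he h hj
  · exact mul_three he h (by omega)
  · obtain ⟨n, rfl⟩ := Nat.exists_eq_add_of_le hi
    exact mul_large he h n j hij (by omega)

theorem mul_sq (he : 10 ≤ e) (h : SallyRel e y) {i : ℕ}
    (hi : i = 2 ∨ i = 3 ∨ (5 ≤ i ∧ i < e)) :
    SallyNF e y (3 * e + 4 + i) (y i * y 2 ^ 2) := by
  obtain rfl | hi' | rfl | rfl : i = 2 ∨ (i = 3 ∨ (5 ≤ i ∧ i ≤ e - 3)) ∨ i = e - 2 ∨ i = e - 1 := by
    omega
  · exact (var 2 6 (by omega)).of_eq (by ring)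
      (by linear_combination h.L6 - h.J0 6 (by omega))
  · exact ((mul_two he h (j := i + 2) (by omega)).pow_mul 1).of_eq (by ring)
      (by linear_combination (-y 2) * h.K i hi')
  · exact (var 3 2 (by omega)).of_eq (by omega) (by linear_combination (-y 2) * h.K0)
  · refine (var 3 3 (by omega)).of_eq (by omega) ?_
    have h1 := h.J 2 (e - 2) (by omega) (by omega) (by omega)
    rw [show e - 2 + 1 = e - 1 by omega] at h1
    linear_combination y 2 * h1 - y (e - 2) * h.K 3 (by omega) - y 0 * h.L3

theorem mul_last (he : 10 ≤ e) (h : SallyRel e y) {i : ℕ}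
    (hi : i = 2 ∨ i = 3 ∨ (5 ≤ i ∧ i < e)) :
    SallyNF e y (4 * e + 1 + i) (y i * (y 2 * y (e - 1))) := by
  obtain rfl | rfl | rfl | hi' : i = 2 ∨ i = 3 ∨ i = 5 ∨ 6 ≤ i := by omega
  · exact (mul_sq he h (i := e - 1) (by omega)).of_eq (by omega) (by ring)
  · exact (sq 2).of_eq (by ring)
      (by linear_combination (-y (e - 1)) * h.K 3 (by omega) - y 0 * h.L4)
  · exact ((mul_sq he h (i := 2) (by omega)).pow_mul 1).of_eq (by ring)
      (by linear_combination (-y 2) * h.L4)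
  · obtain ⟨j, rfl⟩ := Nat.exists_eq_add_of_le' (show 1 ≤ i by omega)
    exact ((mul_two he h (j := j) (by omega)).pow_mul 2).of_eq (by ring)
      (by linear_combination (-y 2) * h.J0 j (by omega))

theorem mul_gen (he : 10 ≤ e) (h : SallyRel e y) {d : ℕ} {a : A} (ha : SallyNF e y d a) {i : ℕ}
    (hi : i < e ∧ i ≠ 1 ∧ i ≠ 4) : SallyNF e y (d + (e + i)) (a * y i) := by
  by_cases h0 : i = 0
  · subst h0
    exact (ha.pow_mul 1).of_eq (by ring) (by ring)
  have hi' : i = 2 ∨ i = 3 ∨ (5 ≤ i ∧ i < e) := by omega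
  cases ha with
  | pow k => exact (var k i hi').of_eq (by ring) rfl
  | var k j hj => exact ((mul_var he h hi' hj).pow_mul k).of_eq (by ring) (by ring)
  | sq k => exact ((mul_sq he h hi').pow_mul k).of_eq (by ring) (by ring)
  | last k => exact ((mul_last he h hi').pow_mul k).of_eq (by ring) (by ring)

end SallyNF

theorem sallyRel_quotient (e : ℕ) :
    SallyRel e (fun i => Ideal.Quotient.mk (Ideal.span (genSet e)) (sX e 1 4 i)) := by
  have key : ∀ p q : MvPolynomial (SallyIdx e 1 4) ℚ, p - q ∈ genSet e →
      Ideal.Quotient.mk (Ideal.span (genSet e)) p = Ideal.Quotient.mk (Ideal.span (genSet e)) q :=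
    fun p q h => Ideal.Quotient.eq.2 (Ideal.subset_span h)
  constructor <;> intros <;> simp only [← map_mul, ← map_pow] <;> apply key
  · exact Or.inl <| Or.inl <| Or.inl <| Or.inl <| Or.inl <| Or.inl ⟨_, _, ‹_›, ‹_›, ‹_›, rfl⟩
  · exact Or.inl <| Or.inl <| Or.inl <| Or.inl <| Or.inl <| Or.inr ⟨_, ‹_›, rfl⟩
  · exact Or.inl <| Or.inl <| Or.inl <| Or.inl <| Or.inr ⟨_, ‹_›, rfl⟩
  · exact Or.inl <| Or.inl <| Or.inl <| Or.inr rfl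
  · exact Or.inl <| Or.inl <| Or.inr ⟨_, ‹_›, rfl⟩
  · exact Or.inl <| Or.inr rfl
  · exact Or.inr <| Or.inl rfl
  · exact Or.inr <| Or.inr <| Or.inl rfl
  · exact Or.inr <| Or.inr <| Or.inr rfl

theorem sallyIdeal_le_span (e : ℕ) (he : 10 ≤ e) :
    sallyIdeal e 1 4 ≤ Ideal.span (genSet e) := by
  classical
  set I := Ideal.span (genSet e)
  set y : ℕ → MvPolynomial (SallyIdx e 1 4) ℚ ⧸ I :=
    fun i => Ideal.Quotient.mk I (sX e 1 4 i) with hy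
  have hrel : SallyRel e y := sallyRel_quotient e
  set φ : MvPolynomial (SallyIdx e 1 4) ℚ →ₐ[ℚ] Polynomial ℚ := MvPolynomial.aeval
    (fun i : SallyIdx e 1 4 => (Polynomial.X : Polynomial ℚ) ^ (e + i.1)) with hφ
  let σ : Polynomial ℚ →ₗ[ℚ] MvPolynomial (SallyIdx e 1 4) ℚ ⧸ I :=
    (Polynomial.basisMonomials ℚ).constr ℚ
      (fun d => if h : ∃ a, SallyNF e y d a then h.choose else 0)
  have hσ : ∀ (c : ℚ) d a, SallyNF e y d a → σ (Polynomial.C c * Polynomial.X ^ d) = c • a := by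
    intro c d a h
    have hex : ∃ a, SallyNF e y d a := ⟨a, h⟩
    have h1 : σ (Polynomial.monomial d 1) = a := by
      have := (Polynomial.basisMonomials ℚ).constr_basis ℚ
        (fun d => if h : ∃ a, SallyNF e y d a then h.choose else 0) d
      rw [Polynomial.coe_basisMonomials] at this
      simp only [σ]
      rw [this, dif_pos hex]
      exact hex.choose_spec.unique he h
    rw [Polynomial.C_mul_X_pow_eq_monomial, show Polynomial.monomial d c =
      c • Polynomial.monomial d (1 : ℚ) by simp [Polynomial.smul_monomial], map_smul, h1]
  have hmon : ∀ m r, ∃ c d a, SallyNF e y d a ∧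
      φ (monomial m r) = Polynomial.C c * Polynomial.X ^ d ∧
      Ideal.Quotient.mk I (monomial m r) = c • a := by
    refine MvPolynomial.induction_on_monomial (fun r => ⟨r, 0, 1, ?_, ?_, ?_⟩) ?_
    · exact (SallyNF.pow 0).of_eq (by ring) (by ring)
    · rw [MvPolynomial.algHom_C, pow_zero, mul_one]
      rfl
    · rw [← Algebra.algebraMap_eq_smul_one]
      rfl
    · rintro p ⟨i, hi⟩ ⟨c, d, a, h1, h2, h3⟩
      refine ⟨c, d + (e + i), a * y i, h1.mul_gen he hrel hi, ?_, ?_⟩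
      · rw [map_mul, h2, hφ, MvPolynomial.aeval_X, pow_add _ d, mul_assoc]
      · rw [map_mul, h3, smul_mul_assoc, hy]
        simp only [sX, dif_pos hi]
  have hsec : ∀ p, σ (φ p) = Ideal.Quotient.mk I p := by
    intro p
    induction p using MvPolynomial.induction_on' with
    | monomial m c =>
      obtain ⟨r, d, a, h1, h2, h3⟩ := hmon m c
      rw [h2, h3, hσ r d a h1]
    | add p q hp hq => rw [map_add, map_add, map_add, hp, hq]
  intro p hp
  have hp' : φ p = 0 := hp
  rw [← Ideal.Quotient.eq_zero_iff_mem, ← hsec, hp', map_zero]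

theorem span_le_sallyIdeal (e : ℕ) (he : 10 ≤ e) :
    Ideal.span (genSet e) ≤ sallyIdeal e 1 4 := by
  rw [Ideal.span_le]
  set φ : MvPolynomial (SallyIdx e 1 4) ℚ →ₐ[ℚ] Polynomial ℚ := MvPolynomial.aeval
    (fun i : SallyIdx e 1 4 => (Polynomial.X : Polynomial ℚ) ^ (e + i.1)) with hφ
  have hX : ∀ i, (i < e ∧ i ≠ 1 ∧ i ≠ 4) → φ (sX e 1 4 i) = Polynomial.X ^ (e + i) := by
    intro i hi
    rw [sX, dif_pos hi, hφ, MvPolynomial.aeval_X]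
  intro p hp
  change φ p = 0
  rcases hp with (((((⟨i, j, hi, hj, hij, rfl⟩ | ⟨i, hi, rfl⟩) | ⟨i, hi, rfl⟩) | rfl) |
    ⟨i, hi, rfl⟩) | rfl) | (rfl | rfl | rfl) <;>
  · simp only [map_sub, map_mul, map_pow]
    repeat rw [hX _ (by omega)]
    simp only [← pow_add, ← pow_mul]
    rw [sub_eq_zero]
    congr 1
    omega

/-- A binomial `x_p x_q - x_a x_b` of `genSet e` with `p < a ≤ b < q`. -/
def IsUpperQuadric (e p q a b : ℕ) : Prop :=
  p + q = a + b ∧ p < a ∧ a ≤ b ∧ q < e ∧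
    ((a = 2 ∧ p = 0 ∧ (b = 3 ∨ 5 ≤ b)) ∨ (a = 3 ∧ p = 2 ∧ 5 ≤ b) ∨ (6 ≤ a ∧ p + 1 = a))

/-- A binomial `x_a x_b - x_p x_q` of `genSet e` with `p < a ≤ b < q`. -/
def IsLowerQuadric (e p q a b : ℕ) : Prop :=
  p + q = a + b ∧ a ≤ b ∧ q < e ∧ ((a = 3 ∧ b = 3 ∧ p = 0) ∨ (a = 5 ∧ p = 3))

/-- A binomial `x_i x_j x_k - x_a x_b` of `genSet e` other than `x_2 ^ 3 - x_7 x_{e-1}`. -/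
def IsCubic (e i j k a b : ℕ) : Prop :=
  i = 0 ∧ ((j = 0 ∧ k = 0 ∧ a = 2 ∧ b + 2 = e) ∨ (j = 0 ∧ k = 2 ∧ a = 3 ∧ b + 1 = e) ∨
    (j = 0 ∧ k = 3 ∧ a = 5 ∧ b + 2 = e) ∨ (j = 2 ∧ k = 2 ∧ a = 5 ∧ b + 1 = e) ∨
    (j = 0 ∧ 5 ≤ k ∧ k + 2 ≤ e ∧ a = k + 1 ∧ b + 1 = e))

theorem genSet_cases {e : ℕ} (he : 10 ≤ e) {h : MvPolynomial (SallyIdx e 1 4) ℚ}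
    (hh : h ∈ genSet e) :
    (∃ p q a b, IsUpperQuadric e p q a b ∧
      h = sX e 1 4 p * sX e 1 4 q - sX e 1 4 a * sX e 1 4 b) ∨
    (∃ p q a b, IsLowerQuadric e p q a b ∧
      h = sX e 1 4 a * sX e 1 4 b - sX e 1 4 p * sX e 1 4 q) ∨
    (∃ i j k a b, IsCubic e i j k a b ∧
      h = sX e 1 4 i * sX e 1 4 j * sX e 1 4 k - sX e 1 4 a * sX e 1 4 b) ∨
    h = sX e 1 4 2 * sX e 1 4 2 * sX e 1 4 2 - sX e 1 4 7 * sX e 1 4 (e - 1) := by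
  unfold IsUpperQuadric IsLowerQuadric IsCubic
  rcases hh with (((((⟨i, j, hi, hj, hij, rfl⟩ | ⟨i, hi, rfl⟩) | ⟨i, hi, rfl⟩) | rfl) |
    ⟨i, hi, rfl⟩) | rfl) | (rfl | rfl | rfl)
  · exact Or.inl ⟨i, j + 1, i + 1, j, by omega, rfl⟩
  · exact Or.inr <| Or.inr <| Or.inl ⟨0, 0, i, i + 1, e - 1, by omega, by ring⟩
  · exact Or.inl ⟨0, i + 2, 2, i, by omega, rfl⟩
  · exact Or.inr <| Or.inr <| Or.inl ⟨0, 0, 0, 2, e - 2, by omega, by ring⟩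
  · exact Or.inr <| Or.inl ⟨3, 7 + i, 5, 5 + i, by omega, rfl⟩
  · exact Or.inr <| Or.inl ⟨0, 6, 3, 3, by omega, by ring⟩
  · exact Or.inr <| Or.inr <| Or.inl ⟨0, 0, 3, 5, e - 2, by omega, by ring⟩
  · exact Or.inr <| Or.inr <| Or.inl ⟨0, 2, 2, 5, e - 1, by omega, by ring⟩
  · exact Or.inr <| Or.inr <| Or.inr (by ring)

open Classical in
/-- The weight which is `1` on the quadratic monomials `x_a x_b` with `a + b = s` and `c ≤ a, b`,
which is `ε` on `x_2 ^ 3`, and which vanishes on all other monomials. -/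
noncomputable def quadWeight (s c : ℕ) (ε : ℚ) (m : ℕ →₀ ℕ) : ℚ :=
  if m.degree = 2 ∧ Finsupp.weight id m = s ∧ ∀ i < c, m i = 0 then 1
  else if m = Finsupp.single 2 3 then ε else 0

/-- The linear functional on polynomials with the values `quadWeight` on monomials. -/
noncomputable def quadFunctional (s c : ℕ) (ε : ℚ) : MvPolynomial ℕ ℚ →ₗ[ℚ] ℚ :=
  (MvPolynomial.basisMonomials ℕ ℚ).constr ℚ (quadWeight s c ε)

section quadFunctional

variable (s c : ℕ) (ε : ℚ)

theorem quadFunctional_monomial (m : ℕ →₀ ℕ) (r : ℚ) :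
    quadFunctional s c ε (monomial m r) = r * quadWeight s c ε m := by
  have h := (MvPolynomial.basisMonomials ℕ ℚ).constr_basis ℚ (quadWeight s c ε) m
  rw [MvPolynomial.coe_basisMonomials] at h
  rw [show monomial m r = r • monomial m (1 : ℚ) by simp [MvPolynomial.smul_monomial], map_smul,
    quadFunctional, h, smul_eq_mul]

theorem monomial_mul_X_mul_X (m : ℕ →₀ ℕ) (r : ℚ) (a b : ℕ) :
    monomial m r * (X a * X b) = monomial (m + (.single a 1 + .single b 1)) r := by
  simp [X, monomial_mul]

theorem monomial_mul_X_mul_X_mul_X (m : ℕ →₀ ℕ) (r : ℚ) (i j k : ℕ) :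
    monomial m r * (X i * X j * X k) =
      monomial (m + (.single i 1 + .single j 1 + .single k 1)) r := by
  simp [X, monomial_mul]

theorem quadWeight_add_quadric {m : ℕ →₀ ℕ} (hm : m ≠ 0) {a b : ℕ} (hab : ¬(a = 2 ∧ b = 2)) :
    quadWeight s c ε (m + (.single a 1 + .single b 1)) = 0 := by
  have hd : m.degree ≠ 0 := by rwa [Ne, Finsupp.degree_eq_zero_iff]
  rw [quadWeight, if_neg, if_neg]
  · intro h
    have ha := DFunLike.congr_fun h a
    have hb := DFunLike.congr_fun h b
    simp only [Finsupp.add_apply, Finsupp.single_apply] at ha hb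
    split_ifs at ha hb <;> omega
  · rintro ⟨h, -⟩
    simp only [map_add, Finsupp.degree_single] at h
    omega

theorem quadWeight_add_cubic {m : ℕ →₀ ℕ} (hm : m ≠ 0) (i j k : ℕ) :
    quadWeight s c ε (m + (.single i 1 + .single j 1 + .single k 1)) = 0 := by
  have hd : m.degree ≠ 0 := by rwa [Ne, Finsupp.degree_eq_zero_iff]
  rw [quadWeight, if_neg, if_neg]
  · intro h
    have h := congrArg Finsupp.degree h
    simp only [map_add, Finsupp.degree_single] at h
    omega
  · rintro ⟨h, -⟩
    simp only [map_add, Finsupp.degree_single] at h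
    omega

theorem quadWeight_quadric (a b : ℕ) :
    quadWeight s c ε (.single a 1 + .single b 1) = if a + b = s ∧ c ≤ a ∧ c ≤ b then 1 else 0 := by
  have h3 : (Finsupp.single a 1 + Finsupp.single b 1 : ℕ →₀ ℕ) ≠ Finsupp.single 2 3 := by
    intro h
    have h := congrArg Finsupp.degree h
    simp only [map_add, Finsupp.degree_single] at h
    omega
  have hc : (∀ i < c, (Finsupp.single a 1 + Finsupp.single b 1 : ℕ →₀ ℕ) i = 0) ↔
      c ≤ a ∧ c ≤ b := by
    constructor
    · intro h
      constructor <;> by_contra! hlt <;> simpa using h _ hlt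
    · rintro ⟨ha, hb⟩ i hi
      rw [Finsupp.add_apply, Finsupp.single_eq_of_ne (by omega),
        Finsupp.single_eq_of_ne (by omega), add_zero]
  simp only [quadWeight, if_neg h3, hc]
  simp [Finsupp.weight_single]

theorem quadWeight_cubic (i j k : ℕ) :
    quadWeight s c ε (.single i 1 + .single j 1 + .single k 1) =
      if i = 2 ∧ j = 2 ∧ k = 2 then ε else 0 := by
  rw [quadWeight, if_neg]
  · congr 1
    apply propext
    constructor
    · intro h
      have hi := DFunLike.congr_fun h i
      have hj := DFunLike.congr_fun h j
      have hk := DFunLike.congr_fun h k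
      simp only [Finsupp.add_apply, Finsupp.single_apply] at hi hj hk
      split_ifs at hi hj hk <;> omega
    · rintro ⟨rfl, rfl, rfl⟩
      simp only [← Finsupp.single_add]
  · rintro ⟨h, -⟩
    simp only [map_add, Finsupp.degree_single] at h
    omega

theorem quadFunctional_quadric (a b : ℕ) :
    quadFunctional s c ε (X a * X b) = if a + b = s ∧ c ≤ a ∧ c ≤ b then 1 else 0 := by
  rw [← quadWeight_quadric s c ε, ← one_mul (quadWeight _ _ _ _), ← quadFunctional_monomial]
  congr 1
  simp [X, monomial_mul]

theorem quadFunctional_cubic (i j k : ℕ) :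
    quadFunctional s c ε (X i * X j * X k) = if i = 2 ∧ j = 2 ∧ k = 2 then ε else 0 := by
  rw [← quadWeight_cubic s c ε, ← one_mul (quadWeight _ _ _ _), ← quadFunctional_monomial]
  congr 1
  simp [X, monomial_mul]

end quadFunctional

theorem rename_sX {e i : ℕ} (hi : i < e ∧ i ≠ 1 ∧ i ≠ 4) :
    rename Subtype.val (sX e 1 4 i) = (X i : MvPolynomial ℕ ℚ) := by
  rw [sX, dif_pos hi, rename_X]

theorem quadFunctional_mul_eq_zero {e : ℕ} (he : 10 ≤ e) (s c : ℕ) (ε : ℚ)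
    {h : MvPolynomial (SallyIdx e 1 4) ℚ} (hh : h ∈ genSet e)
    (h0 : quadFunctional s c ε (rename Subtype.val h) = 0) (p : MvPolynomial ℕ ℚ) :
    quadFunctional s c ε (p * rename Subtype.val h) = 0 := by
  induction p using MvPolynomial.induction_on' with
  | add p q hp hq => rw [add_mul, map_add, hp, hq, add_zero]
  | monomial m r =>
    by_cases hm : m = 0
    · subst hm
      rw [← C_apply, C_mul', map_smul, h0, smul_zero]
    obtain ⟨p, q, a, b, H, rfl⟩ | ⟨p, q, a, b, H, rfl⟩ | ⟨i, j, k, a, b, H, rfl⟩ | rfl :=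
      genSet_cases he hh
    · unfold IsUpperQuadric at H
      simp only [map_sub, map_mul]
      repeat rw [rename_sX (by omega)]
      rw [mul_sub, map_sub, monomial_mul_X_mul_X, monomial_mul_X_mul_X, quadFunctional_monomial,
        quadFunctional_monomial, quadWeight_add_quadric s c ε hm (by omega),
        quadWeight_add_quadric s c ε hm (by omega), sub_self]
    · unfold IsLowerQuadric at H
      simp only [map_sub, map_mul]
      repeat rw [rename_sX (by omega)]
      rw [mul_sub, map_sub, monomial_mul_X_mul_X, monomial_mul_X_mul_X, quadFunctional_monomial,
        quadFunctional_monomial, quadWeight_add_quadric s c ε hm (by omega),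
        quadWeight_add_quadric s c ε hm (by omega), sub_self]
    · unfold IsCubic at H
      simp only [map_sub, map_mul]
      repeat rw [rename_sX (by omega)]
      rw [mul_sub, map_sub, monomial_mul_X_mul_X_mul_X, monomial_mul_X_mul_X,
        quadFunctional_monomial, quadFunctional_monomial, quadWeight_add_cubic s c ε hm,
        quadWeight_add_quadric s c ε hm (by omega), sub_self]
    · simp only [map_sub, map_mul]
      repeat rw [rename_sX (by omega)]
      rw [mul_sub, map_sub, monomial_mul_X_mul_X_mul_X, monomial_mul_X_mul_X,
        quadFunctional_monomial, quadFunctional_monomial, quadWeight_add_cubic s c ε hm,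
        quadWeight_add_quadric s c ε hm (by omega), sub_self]

theorem quadFunctional_eq_zero_of_mem_span {e : ℕ} (he : 10 ≤ e) (s c : ℕ) (ε : ℚ)
    {G : Set (MvPolynomial (SallyIdx e 1 4) ℚ)} (hG : G ⊆ genSet e)
    (h0 : ∀ h ∈ G, quadFunctional s c ε (rename Subtype.val h) = 0)
    {f : MvPolynomial (SallyIdx e 1 4) ℚ} (hf : f ∈ Ideal.span G) :
    quadFunctional s c ε (rename Subtype.val f) = 0 := by
  suffices H : ∀ p, quadFunctional s c ε (p * rename Subtype.val f) = 0 by simpa using H 1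
  induction hf using Submodule.span_induction with
  | mem h hh => exact quadFunctional_mul_eq_zero he s c ε (hG hh) (h0 h hh)
  | zero => simp
  | add f g _ _ hf hg => intro p; rw [map_add, mul_add, map_add, hf, hg, add_zero]
  | smul r f _ hf => intro p; rw [smul_eq_mul, map_mul (rename _), ← mul_assoc, hf]

section values

variable {e : ℕ} (s c : ℕ) (ε : ℚ)

theorem quadFunctional_upper {p q a b : ℕ} (H : IsUpperQuadric e p q a b) :
    quadFunctional s c ε (rename Subtype.val
      (sX e 1 4 p * sX e 1 4 q - sX e 1 4 a * sX e 1 4 b)) =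
      if a + b = s ∧ p < c ∧ c ≤ a then -1 else 0 := by
  unfold IsUpperQuadric at H
  simp only [map_sub, map_mul]
  repeat rw [rename_sX (by omega)]
  rw [quadFunctional_quadric, quadFunctional_quadric]
  split_ifs <;> first | omega | norm_num

theorem quadFunctional_lower {p q a b : ℕ} (H : IsLowerQuadric e p q a b) :
    quadFunctional s c ε (rename Subtype.val
      (sX e 1 4 a * sX e 1 4 b - sX e 1 4 p * sX e 1 4 q)) =
      if a + b = s ∧ p < c ∧ c ≤ a then 1 else 0 := by
  unfold IsLowerQuadric at H
  simp only [map_sub, map_mul]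
  repeat rw [rename_sX (by omega)]
  rw [quadFunctional_quadric, quadFunctional_quadric]
  split_ifs <;> first | omega | norm_num

theorem quadFunctional_mixed (he : 10 ≤ e) {i j k a b : ℕ} (H : IsCubic e i j k a b) :
    quadFunctional s c ε (rename Subtype.val
      (sX e 1 4 i * sX e 1 4 j * sX e 1 4 k - sX e 1 4 a * sX e 1 4 b)) =
      if a + b = s ∧ c ≤ a then -1 else 0 := by
  unfold IsCubic at H
  simp only [map_sub, map_mul]
  repeat rw [rename_sX (by omega)]
  rw [quadFunctional_quadric, quadFunctional_cubic]
  split_ifs <;> first | omega | norm_num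

theorem quadFunctional_cube (he : 10 ≤ e) :
    quadFunctional s c ε (rename Subtype.val
      (sX e 1 4 2 * sX e 1 4 2 * sX e 1 4 2 - sX e 1 4 7 * sX e 1 4 (e - 1))) =
      ε - if s = e + 6 ∧ c ≤ 7 then 1 else 0 := by
  simp only [map_sub, map_mul]
  repeat rw [rename_sX (by omega)]
  rw [quadFunctional_quadric, quadFunctional_cubic]
  split_ifs <;> first | omega | norm_num

end values

/-- Each element of `genSet e` is detected by a functional vanishing on all the other ones. -/
theorem exists_quadFunctional {e : ℕ} (he : 10 ≤ e) {g : MvPolynomial (SallyIdx e 1 4) ℚ}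
    (hg : g ∈ genSet e) :
    ∃ s c ε, quadFunctional s c ε (rename Subtype.val g) ≠ 0 ∧
      ∀ h ∈ genSet e, h ≠ g → quadFunctional s c ε (rename Subtype.val h) = 0 := by
  obtain ⟨p, q, a, b, H, rfl⟩ | ⟨p, q, a, b, H, rfl⟩ | ⟨i, j, k, a, b, H, rfl⟩ | rfl :=
    genSet_cases he hg
  · refine ⟨a + b, a, 0, ?_, fun h hh hne => ?_⟩
    · rw [quadFunctional_upper _ _ _ H, if_pos ⟨rfl, H.2.1, le_rfl⟩]
      norm_num
    obtain ⟨p', q', a', b', H', rfl⟩ | ⟨p', q', a', b', H', rfl⟩ |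
      ⟨i', j', k', a', b', H', rfl⟩ | rfl := genSet_cases he hh
    · rw [quadFunctional_upper _ _ _ H', if_neg]
      intro hab
      unfold IsUpperQuadric at H H'
      obtain ⟨rfl, rfl, rfl, rfl⟩ : p' = p ∧ q' = q ∧ a' = a ∧ b' = b := by omega
      exact hne rfl
    · rw [quadFunctional_lower _ _ _ H', if_neg]
      unfold IsUpperQuadric at H
      unfold IsLowerQuadric at H'
      omega
    · rw [quadFunctional_mixed _ _ _ he H', if_neg]
      unfold IsUpperQuadric at H
      unfold IsCubic at H'
      omega
    · rw [quadFunctional_cube _ _ _ he, if_neg, sub_zero]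
      unfold IsUpperQuadric at H
      omega
  · refine ⟨a + b, a, 0, ?_, fun h hh hne => ?_⟩
    · rw [quadFunctional_lower _ _ _ H, if_pos]
      · norm_num
      · unfold IsLowerQuadric at H
        omega
    obtain ⟨p', q', a', b', H', rfl⟩ | ⟨p', q', a', b', H', rfl⟩ |
      ⟨i', j', k', a', b', H', rfl⟩ | rfl := genSet_cases he hh
    · rw [quadFunctional_upper _ _ _ H', if_neg]
      unfold IsLowerQuadric at H
      unfold IsUpperQuadric at H'
      omega
    · rw [quadFunctional_lower _ _ _ H', if_neg]
      intro hab
      unfold IsLowerQuadric at H H'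
      obtain ⟨rfl, rfl, rfl, rfl⟩ : p' = p ∧ q' = q ∧ a' = a ∧ b' = b := by omega
      exact hne rfl
    · rw [quadFunctional_mixed _ _ _ he H', if_neg]
      unfold IsLowerQuadric at H
      unfold IsCubic at H'
      omega
    · rw [quadFunctional_cube _ _ _ he, if_neg, sub_zero]
      unfold IsLowerQuadric at H
      omega
  · refine ⟨a + b, 0, if a + b = e + 6 then 1 else 0, ?_, fun h hh hne => ?_⟩
    · rw [quadFunctional_mixed _ _ _ he H, if_pos ⟨rfl, Nat.zero_le _⟩]
      norm_num
    obtain ⟨p', q', a', b', H', rfl⟩ | ⟨p', q', a', b', H', rfl⟩ |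
      ⟨i', j', k', a', b', H', rfl⟩ | rfl := genSet_cases he hh
    · rw [quadFunctional_upper _ _ _ H', if_neg (by omega)]
    · rw [quadFunctional_lower _ _ _ H', if_neg (by omega)]
    · rw [quadFunctional_mixed _ _ _ he H', if_neg]
      intro hab
      unfold IsCubic at H H'
      obtain ⟨rfl, rfl, rfl, rfl, rfl⟩ : i' = i ∧ j' = j ∧ k' = k ∧ a' = a ∧ b' = b := by omega
      exact hne rfl
    · rw [quadFunctional_cube _ _ _ he]
      simp
  · refine ⟨0, e, 1, ?_, fun h hh hne => ?_⟩
    · rw [quadFunctional_cube _ _ _ he, if_neg (by omega)]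
      norm_num
    obtain ⟨p', q', a', b', H', rfl⟩ | ⟨p', q', a', b', H', rfl⟩ |
      ⟨i', j', k', a', b', H', rfl⟩ | rfl := genSet_cases he hh
    · rw [quadFunctional_upper _ _ _ H', if_neg (by omega)]
    · rw [quadFunctional_lower _ _ _ H', if_neg (by omega)]
    · rw [quadFunctional_mixed _ _ _ he H', if_neg (by omega)]
    · exact absurd rfl hne

theorem stmt2 (e : ℕ) (he : 10 ≤ e) :
    Ideal.span (genSet e) = sallyIdeal e 1 4 ∧
    ∀ G' : Set (MvPolynomial (SallyIdx e 1 4) ℚ), G' ⊂ genSet e →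
      Ideal.span G' ≠ sallyIdeal e 1 4 := by
  have hspan := le_antisymm (span_le_sallyIdeal e he) (sallyIdeal_le_span e he)
  refine ⟨hspan, fun G' hG' heq => ?_⟩
  obtain ⟨g, hg, hgG'⟩ := Set.exists_of_ssubset hG'
  obtain ⟨s, c, ε, hne, hzero⟩ := exists_quadFunctional he hg
  refine hne (quadFunctional_eq_zero_of_mem_span he s c ε hG'.subset
    (fun h hh => hzero h (hG'.subset hh) ?_) ?_)
  · rintro rfl
    exact hgG' hh
  · rw [heq, ← hspan]
    exact Ideal.subset_span hg
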